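/- Let G be a group containing an infinite torsion-free abelian normal subgroup. Then G has the property K̄ if and only if G has the property K̄∞. -/

import Mathlib

/-- A group `G` has property K̄ if for every subgroup `X` of `G` the set of
subgroups of the form `⁅X, H⁆`, with `H` ranging over subgroups of `G`, is finite. -/
def PropK (G : Type*) [Group G] : Prop :=
  ∀ X : Subgroup G, {S : Subgroup G | ∃ H : Subgroup G, S = ⁅X, H⁆}.Finite

/-- A group `G` has property K̄∞ if for every subgroup `X` of `G` the set of
subgroups of the form `⁅X, H⁆`, with `H` ranging over infinite subgroups of `G`,
is finite. -/
def PropKInf (G : Type*) [Group G] : Prop :=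
  ∀ X : Subgroup G, {S : Subgroup G | ∃ H : Subgroup G, Infinite H ∧ S = ⁅X, H⁆}.Finite

open scoped commutatorElement

theorem jacobson_int : IsJacobsonRing ℤ := by
  rw [isJacobsonRing_iff_prime_eq]
  intro P hP
  by_cases h : P = ⊥
  · subst h
    rw [eq_bot_iff]
    intro k hk
    rw [Ideal.mem_jacobson_bot] at hk
    have h1 := Int.isUnit_iff.mp (hk k)
    have h2 : k = 0 := by
      rcases h1 with h1 | h1 <;> nlinarith [mul_self_nonneg k]
    simp [h2]
  · have := hP.isMaximal h
    exact Ideal.jacobson_eq_self_of_isMaximal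

theorem ft_int (C : Type*) [CommRing C] (inst : Algebra ℤ C)
    (h : @Algebra.FiniteType ℤ C _ _ inst) : @Algebra.FiniteType ℤ C _ _ (Ring.toIntAlgebra C) := by
  have e : Ring.toIntAlgebra C = inst := Subsingleton.elim _ _
  rw [e]
  exact h

theorem fg_int : AddMonoid.FG ℤ := by
  rw [← AddGroup.fg_iff_addMonoid_fg, ← Module.Finite.iff_addGroup_fg]
  infer_instance

theorem key_div (C V : Type*) [CommRing C] [Algebra.FiniteType ℤ C] [AddCommGroup V] [Module C V]
    (m : V) (hm : m ≠ 0) : ∃ n : ℕ, n ≠ 0 ∧ ∀ f : C, (n : C) • f • m ≠ m := by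
  by_contra! hcon
  let I : Ideal C := LinearMap.ker (LinearMap.toSpanSingleton C V m)
  have hI : I ≠ ⊤ := by
    intro h
    have h1 : (1 : C) ∈ I := by rw [h]; trivial
    apply hm
    simpa [I] using h1
  obtain ⟨J, hJ, hIJ⟩ := Ideal.exists_le_maximal I hI
  letI : Field (C ⧸ J) := Ideal.Quotient.field J
  have hft : Algebra.FiniteType ℤ (C ⧸ J) :=
    Algebra.FiniteType.of_surjective (Ideal.Quotient.mkₐ ℤ J) (Ideal.Quotient.mkₐ_surjective ℤ J)
  have := jacobson_int
  have hfin : Module.Finite ℤ (C ⧸ J) := finite_of_finite_type_of_isJacobsonRing ℤ (C ⧸ J)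
  have hne : ∀ n : ℕ, n ≠ 0 → (n : C ⧸ J) ≠ 0 := by
    intro n hn h0
    obtain ⟨f, hf⟩ := hcon n hn
    have h1 : (n : C) * f - 1 ∈ I := by
      simp [I, sub_smul, mul_smul, hf]
    have h2 := Ideal.Quotient.eq_zero_iff_mem.mpr (hIJ h1)
    rw [map_sub, map_mul, map_natCast, h0] at h2
    simp at h2
  have hc : CharZero (C ⧸ J) := by
    refine charZero_of_inj_zero fun n hn => ?_
    by_contra h
    exact hne n h hn
  have hinj : Function.Injective (algebraMap ℤ (C ⧸ J)) := (algebraMap ℤ (C ⧸ J)).injective_int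
  have := isField_of_isIntegral_of_isField hinj (Field.toIsField (C ⧸ J))
  exact Int.not_isField this

theorem T_sub_one (s : ℤ) : ∃ g : LaurentPolynomial ℤ,
    (LaurentPolynomial.T s - 1 : LaurentPolynomial ℤ) = g * (LaurentPolynomial.T 1 - 1) := by
  induction s using Int.induction_on with
  | zero => exact ⟨0, by simp⟩
  | succ i ih =>
    obtain ⟨g, hg⟩ := ih
    refine ⟨g + LaurentPolynomial.T i, ?_⟩
    rw [add_mul, ← hg, mul_sub, ← LaurentPolynomial.T_add]; ring
  | pred i ih =>
    obtain ⟨g, hg⟩ := ih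
    refine ⟨g - LaurentPolynomial.T (-i - 1), ?_⟩
    rw [sub_mul, ← hg, mul_sub, ← LaurentPolynomial.T_add]; simp

theorem central_of_KInf (G : Type*) [Group G] (A : Subgroup G) (hnorm : A.Normal)
    (hab : ∀ x y : A, x * y = y * x)
    (htf : ∀ a ∈ A, a ≠ 1 → ¬IsOfFinOrder a) (hK : PropKInf G) (x : G) (a : A) :
    ⁅x, (a : G)⁆ = 1 := by
  by_contra hne
  letI : CommGroup A := { (inferInstance : Group A) with mul_comm := hab }
  let F : Multiplicative ℤ →* Module.End ℤ (Additive A) :=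
    { toFun := fun s => (MonoidHom.toAdditive
        (MulAut.conjNormal (H := A) (x ^ (Multiplicative.toAdd s))).toMonoidHom).toIntLinearMap
      map_one' := by ext v; simp
      map_mul' := by
        intro s t
        ext v
        simp [zpow_add, mul_assoc] }
  let Φ : LaurentPolynomial ℤ →ₐ[ℤ] Module.End ℤ (Additive A) :=
    AddMonoidAlgebra.lift ℤ (Module.End ℤ (Additive A)) ℤ F
  letI : Module (LaurentPolynomial ℤ) (Additive A) := Module.compHom _ Φ.toRingHom
  have hT : ∀ (s : ℤ) (v : Additive A),
      (((LaurentPolynomial.T s : LaurentPolynomial ℤ) • v).toMul : G)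
        = x ^ s * (v.toMul : G) * (x ^ s)⁻¹ := by
    intro s v
    have : (LaurentPolynomial.T s : LaurentPolynomial ℤ) • v = F (Multiplicative.ofAdd s) v := by
      change Φ (LaurentPolynomial.T s) v = _
      change AddMonoidAlgebra.lift ℤ (Module.End ℤ (Additive A)) ℤ F (AddMonoidAlgebra.single s 1) v = _
      rw [AddMonoidAlgebra.lift_single, one_smul]
    rw [this]
    exact MulAut.conjNormal_apply (H := A) (x ^ s) v.toMul
  have hcomm : ∀ (s : ℤ) (v : Additive A), ⁅x ^ s, (v.toMul : G)⁆ =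
      ((((LaurentPolynomial.T s - 1 : LaurentPolynomial ℤ) • v)).toMul : G) := by
    intro s v
    rw [sub_smul, one_smul, toMul_sub, Subgroup.coe_div, hT, commutatorElement_def, div_eq_mul_inv]
  let a' : Additive A := Additive.ofMul a
  let m : Additive A := (LaurentPolynomial.T 1 - 1 : LaurentPolynomial ℤ) • a'
  have hmc : ((m.toMul : A) : G) = ⁅x, (a : G)⁆ := by
    have := hcomm 1 a'
    rw [zpow_one] at this
    exact this.symm
  have hm : m ≠ 0 := by
    intro h
    apply hne
    rw [← hmc, h]; simp
  have ha : (a : G) ≠ 1 := by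
    intro h
    apply hne
    rw [h]; simp
  have htfA : ∀ (k : ℕ) (v : Additive A), k ≠ 0 → k • v = 0 → v = 0 := by
    intro k v hk hv
    by_contra hv0
    refine htf (v.toMul : A) (v.toMul : A).2 ?_ ?_
    · intro h
      apply hv0
      have : v.toMul = 1 := Subtype.ext h
      exact this
    · rw [isOfFinOrder_iff_pow_eq_one]
      refine ⟨k, Nat.pos_of_ne_zero hk, ?_⟩
      rw [← Subgroup.coe_pow, ← toMul_nsmul, hv]; simp
  have := fg_int
  have hft := ft_int (LaurentPolynomial ℤ) _ (AddMonoidAlgebra.finiteType_of_fg ℤ ℤ)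
  obtain ⟨n, hn0, hn⟩ := key_div (LaurentPolynomial ℤ) (Additive A) m hm
  have hn1 : n ≠ 1 := by
    rintro rfl
    exact hn 1 (by simp)
  let H : ℕ → Subgroup G := fun j => Subgroup.zpowers ((a : G) ^ (n ^ j))
  have hHinf : ∀ j, Infinite (H j) := by
    intro j
    rw [← not_finite_iff_infinite]
    change ¬ (Subgroup.zpowers ((a : G) ^ (n ^ j)) : Set G).Finite
    rw [finite_zpowers]
    intro h
    exact htf a a.2 ha ((isOfFinOrder_pow.mp h).resolve_right (pow_ne_zero _ hn0))
  have hfin := hK (Subgroup.zpowers x)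
  have hnotinj : ∃ i j : ℕ, i < j ∧
      ⁅Subgroup.zpowers x, H i⁆ = ⁅Subgroup.zpowers x, H j⁆ := by
    obtain ⟨i, -, j, -, hij, h⟩ := Set.infinite_univ.exists_ne_map_eq_of_mapsTo
      (f := fun j => ⁅Subgroup.zpowers x, H j⁆) (t := {S : Subgroup G | ∃ L : Subgroup G, Infinite L ∧ S = ⁅Subgroup.zpowers x, L⁆})
      (fun j _ => ⟨H j, hHinf j, rfl⟩) hfin
    rcases lt_or_gt_of_ne hij with h' | h'
    · exact ⟨i, j, h', h⟩
    · exact ⟨j, i, h', h.symm⟩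
  obtain ⟨i, j, hij, hEq⟩ := hnotinj
  let K : Subgroup G :=
    { carrier := {g | ∃ f : LaurentPolynomial ℤ, g = (((n ^ j) • f • m : Additive A).toMul : G)}
      one_mem' := ⟨0, by simp⟩
      mul_mem' := by
        rintro _ _ ⟨f, rfl⟩ ⟨g, rfl⟩
        exact ⟨f + g, by rw [add_smul, smul_add, toMul_add, Subgroup.coe_mul]⟩
      inv_mem' := by
        rintro _ ⟨f, rfl⟩
        exact ⟨-f, by rw [neg_smul, smul_neg, toMul_neg, Subgroup.coe_inv]⟩ }
  have hle : ⁅Subgroup.zpowers x, H j⁆ ≤ K := by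
    rw [Subgroup.commutator_le]
    rintro _ ⟨s, rfl⟩ _ ⟨t, rfl⟩
    obtain ⟨g, hg⟩ := T_sub_one s
    refine ⟨t • g, ?_⟩
    have h1 : ((a : G) ^ (n ^ j)) ^ t = ((t • (n ^ j) • a' : Additive A).toMul : G) := by
      simp [a']
    simp only [h1]
    rw [hcomm, hg]
    congr 2
    simp only [m, smul_smul, ← Int.cast_smul_eq_zsmul (LaurentPolynomial ℤ),
      ← Nat.cast_smul_eq_nsmul (LaurentPolynomial ℤ), smul_eq_mul]
    congr 1
    ring
  have hmem : ⁅x, (a : G) ^ (n ^ i)⁆ ∈ K := by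
    apply hle
    rw [← hEq]
    exact Subgroup.commutator_mem_commutator (Subgroup.mem_zpowers x) (Subgroup.mem_zpowers _)
  obtain ⟨f, hf⟩ := hmem
  have h2 : ⁅x, (a : G) ^ (n ^ i)⁆ = (((n ^ i) • m : Additive A).toMul : G) := by
    have := hcomm 1 ((n ^ i) • a')
    rw [zpow_one, smul_comm] at this
    rw [← this]
    simp [a']
  rw [h2] at hf
  have h3 : (n ^ i) • m = (n ^ j) • f • m := Additive.toMul.injective (Subtype.ext hf)
  obtain ⟨d, rfl⟩ := Nat.exists_eq_add_of_lt hij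
  have h4 : m - (n ^ (d + 1)) • f • m = 0 := by
    apply htfA (n ^ i) _ (pow_ne_zero _ hn0)
    rw [smul_sub, smul_smul, ← pow_add, h3, add_assoc, sub_self]
  apply hn ((n : LaurentPolynomial ℤ) ^ d * f)
  have h5 := (sub_eq_zero.mp h4).symm
  rw [← Nat.cast_smul_eq_nsmul (LaurentPolynomial ℤ), smul_smul] at h5
  rw [smul_smul]
  convert h5 using 2
  push_cast
  ring

theorem stmt_12 (G : Type*) [Group G] (A : Subgroup G) (hnorm : A.Normal)
    (hinf : Infinite A) (hab : ∀ x y : A, x * y = y * x)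
    (htf : ∀ a ∈ A, a ≠ 1 → ¬IsOfFinOrder a) :
    PropK G ↔ PropKInf G := by
  constructor
  · intro h X
    refine (h X).subset ?_
    rintro S ⟨H, -, rfl⟩
    exact ⟨H, rfl⟩
  · intro h X
    have hc := central_of_KInf G A hnorm hab htf h
    refine (h X).subset ?_
    rintro S ⟨H, rfl⟩
    refine ⟨H ⊔ A, ?_, ?_⟩
    · exact Infinite.of_injective (Subgroup.inclusion (le_sup_right : A ≤ H ⊔ A))
        (Subgroup.inclusion_injective _)
    · apply le_antisymm
      · exact Subgroup.commutator_mono le_rfl le_sup_left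
      · rw [Subgroup.commutator_le]
        intro g hg y hy
        obtain ⟨u, hu, v, hv, rfl⟩ := Subgroup.mem_sup_of_normal_right.mp hy
        have hgv := hc g ⟨v, hv⟩
        rw [commutatorElement_eq_one_iff_mul_comm] at hgv
        have : ⁅g, u * v⁆ = ⁅g, u⁆ := by
          have e := hc (u⁻¹ * g⁻¹ * u) ⟨v, hv⟩
          have e1 := hc (g * u) ⟨v, hv⟩
          have e2 := hc (u * g) ⟨v, hv⟩
          have e3 := hc (g⁻¹) ⟨v, hv⟩
          rw [commutatorElement_eq_one_iff_mul_comm] at e3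
          simp only at e3
          calc ⁅g, u * v⁆ = g * u * (v * g⁻¹) * v⁻¹ * u⁻¹ := by
                rw [commutatorElement_def]; group
            _ = ⁅g, u⁆ := by rw [← e3, commutatorElement_def]; group
        rw [this]
        exact Subgroup.commutator_mem_commutator hg hu
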